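/- arXiv:2209.08426 — 2 statements merged into one kernel-verified Lean document; each statement's English description precedes it below -/
import Mathlib

section
/- Define q, r : ℝ × ℝ → ℂ by q(x,t) = 6 e^{−2x+4it} (18 e^{6x} − 27 i e^{2x} − 4 i e^{12it}) (18 e^{6x} + 6 e^{4x+12it} − i e^{12it}) / (18 e^{6x} + 27 i e^{2x} + 8 i e^{12it})² and r(x,t) = −72 e^{4x−4it} (18 e^{6x} + 27 i e^{2x} + 8 i e^{12it}) / (18 i e^{6x} + 27 e^{2x} + 4 e^{12it})². Then at every point (x,t) ∈ ℝ² at which 18 e^{6x} + 27 i e^{2x} + 8 i e^{12it} ≠ 0 and 18 i e^{6x} + 27 e^{2x} + 4 e^{12it} ≠ 0, the pair (q, r) satisfies the Kaup–Newell system i q_t + q_xx − i (q² r)_x = 0 and i r_t − r_xx − i (q r²)_x = 0. -/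
/-- Partial derivative with respect to the first (spatial) variable. -/
noncomputable def pdx (f : ℝ × ℝ → ℂ) (p : ℝ × ℝ) : ℂ :=
  deriv (fun s => f (s, p.2)) p.1

/-- Partial derivative with respect to the second (time) variable. -/
noncomputable def pdt (f : ℝ × ℝ → ℂ) (p : ℝ × ℝ) : ℂ :=
  deriv (fun s => f (p.1, s)) p.2

/-- Second partial derivative with respect to the spatial variable. -/
noncomputable def pdxx (f : ℝ × ℝ → ℂ) (p : ℝ × ℝ) : ℂ :=
  deriv (fun s => pdx f (s, p.2)) p.1

/-- The explicit potential `q(x,t)` of Example 9.1. -/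
noncomputable def qEx (p : ℝ × ℝ) : ℂ :=
  6 * Complex.exp (-2 * (p.1 : ℂ) + 4 * Complex.I * (p.2 : ℂ))
      * (18 * Complex.exp (6 * (p.1 : ℂ)) - 27 * Complex.I * Complex.exp (2 * (p.1 : ℂ))
          - 4 * Complex.I * Complex.exp (12 * Complex.I * (p.2 : ℂ)))
      * (18 * Complex.exp (6 * (p.1 : ℂ))
          + 6 * Complex.exp (4 * (p.1 : ℂ) + 12 * Complex.I * (p.2 : ℂ))
          - Complex.I * Complex.exp (12 * Complex.I * (p.2 : ℂ)))
    / (18 * Complex.exp (6 * (p.1 : ℂ)) + 27 * Complex.I * Complex.exp (2 * (p.1 : ℂ))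
        + 8 * Complex.I * Complex.exp (12 * Complex.I * (p.2 : ℂ))) ^ 2

/-- The explicit potential `r(x,t)` of Example 9.1. -/
noncomputable def rEx (p : ℝ × ℝ) : ℂ :=
  -(72 * Complex.exp (4 * (p.1 : ℂ) - 4 * Complex.I * (p.2 : ℂ))
      * (18 * Complex.exp (6 * (p.1 : ℂ)) + 27 * Complex.I * Complex.exp (2 * (p.1 : ℂ))
          + 8 * Complex.I * Complex.exp (12 * Complex.I * (p.2 : ℂ))))
    / (18 * Complex.I * Complex.exp (6 * (p.1 : ℂ)) + 27 * Complex.exp (2 * (p.1 : ℂ))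
        + 4 * Complex.exp (12 * Complex.I * (p.2 : ℂ))) ^ 2


open Complex in
/-- Both equations in one form: `f(·,t) = A/D²`, the cubic term is `C/D³`. -/
lemma kn_generic (f : ℝ × ℝ → ℂ) (g A A1 A2 D D1 D2 C E F : ℝ → ℂ) (x t : ℝ)
    (σ C1 E1 F1 : ℂ)
    (hf : ∀ s, f (s, t) = A s / D s ^ 2)
    (hft : ∀ s, f (x, s) = E s / F s ^ 2)
    (hEA : E t = A x) (hFD : F t = D x)
    (hg : ∀ᶠ s in nhds x, g s = C s / D s ^ 3)
    (hA : ∀ s, HasDerivAt A (A1 s) s) (hA1 : HasDerivAt A1 (A2 x) x)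
    (hD : ∀ s, HasDerivAt D (D1 s) s) (hD1 : HasDerivAt D1 (D2 x) x)
    (hC : HasDerivAt C C1 x) (hE : HasDerivAt E E1 t) (hF : HasDerivAt F F1 t)
    (hne : D x ≠ 0)
    (key : I * (E1 * D x - 2 * A x * F1) * D x
      + σ * ((A2 x * D x - A1 x * D1 x - 2 * A x * D2 x) * D x
          - 3 * (A1 x * D x - 2 * A x * D1 x) * D1 x)
      - I * (C1 * D x - 3 * C x * D1 x) = 0) :
    I * pdt f (x, t) + σ * pdxx f (x, t) - I * deriv g x = 0 := by
  have hFt : F t ≠ 0 := by rw [hFD]; exact hne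
  have h1 : pdt f (x, t) = (E1 * D x - 2 * A x * F1) / D x ^ 3 := by
    have : HasDerivAt (fun s => f (x, s)) _ t :=
      (hE.div (hF.pow 2) (pow_ne_zero 2 hFt)).congr_of_eventuallyEq
        (Filter.Eventually.of_forall hft)
    unfold pdt
    rw [this.deriv]
    simp only [hEA, hFD, Pi.pow_apply]
    field_simp
    push_cast
    ring
  have hev : ∀ᶠ s in nhds x, D s ≠ 0 := (hD x).continuousAt.eventually_ne hne
  have h2 : ∀ᶠ s in nhds x, pdx f (s, t) = (A1 s * D s - 2 * A s * D1 s) / D s ^ 3 := by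
    filter_upwards [hev] with s hs
    have : HasDerivAt (fun s => f (s, t)) _ s :=
      ((hA s).div ((hD s).pow 2) (pow_ne_zero 2 hs)).congr_of_eventuallyEq
        (Filter.Eventually.of_forall hf)
    unfold pdx
    rw [this.deriv]
    simp only [Pi.pow_apply]
    field_simp
    push_cast
    ring
  have h3 : pdxx f (x, t) = ((A2 x * D x - A1 x * D1 x - 2 * A x * D2 x) * D x
          - 3 * (A1 x * D x - 2 * A x * D1 x) * D1 x) / D x ^ 4 := by
    unfold pdxx
    rw [Filter.EventuallyEq.deriv_eq h2]
    have : HasDerivAt (fun s => (A1 s * D s - 2 * A s * D1 s) / D s ^ 3) _ x :=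
      ((hA1.mul (hD x)).sub (((hA x).const_mul 2).mul hD1)).div ((hD x).pow 3)
        (pow_ne_zero 3 hne)
    rw [this.deriv]
    simp only [Pi.pow_apply, Pi.mul_apply, Pi.sub_apply]
    field_simp
    push_cast
    ring
  have h4 : deriv g x = (C1 * D x - 3 * C x * D1 x) / D x ^ 4 := by
    rw [Filter.EventuallyEq.deriv_eq hg]
    have : HasDerivAt (fun s => C s / D s ^ 3) _ x :=
      hC.div ((hD x).pow 3) (pow_ne_zero 3 hne)
    rw [this.deriv]
    field_simp
    push_cast
    ring
  rw [h1, h3, h4]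
  have : I * ((E1 * D x - 2 * A x * F1) / D x ^ 3)
      + σ * (((A2 x * D x - A1 x * D1 x - 2 * A x * D2 x) * D x
          - 3 * (A1 x * D x - 2 * A x * D1 x) * D1 x) / D x ^ 4)
      - I * ((C1 * D x - 3 * C x * D1 x) / D x ^ 4)
      = (I * (E1 * D x - 2 * A x * F1) * D x
      + σ * ((A2 x * D x - A1 x * D1 x - 2 * A x * D2 x) * D x
          - 3 * (A1 x * D x - 2 * A x * D1 x) * D1 x)
      - I * (C1 * D x - 3 * C x * D1 x)) / D x ^ 4 := by
    field_simp
  rw [this, key, zero_div]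

lemma hasDerivAt_cexp_mul (c : ℂ) (s : ℝ) :
    HasDerivAt (fun s : ℝ => Complex.exp (c * (s : ℂ))) (c * Complex.exp (c * (s : ℂ))) s := by
  have h : HasDerivAt (fun z : ℂ => Complex.exp (c * z)) (c * Complex.exp (c * (s : ℂ))) (s : ℂ) := by
    have := ((hasDerivAt_id (s : ℂ)).const_mul c).cexp
    exact this.congr_deriv (by simp [mul_comm])
  exact h.comp_ofReal

/-- Polynomials in `X` whose variable satisfies `X' = c X`, of the shape `aX³ + bX² + dX + e`. -/
lemma hasDerivAt_cubic {X : ℝ → ℂ} {k : ℂ} {s : ℝ} (hX : HasDerivAt X (k * X s) s)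
    (a b d e : ℂ) :
    HasDerivAt (fun s => a * X s ^ 3 + b * X s ^ 2 + d * X s + e)
      (3 * k * a * X s ^ 3 + 2 * k * b * X s ^ 2 + k * d * X s + 0) s := by
  have := ((((hX.pow 3).const_mul a).add ((hX.pow 2).const_mul b)).add
    (hX.const_mul d)).add_const e
  exact this.congr_deriv (by push_cast; ring)

open Complex in
lemma qEx_eq (x t : ℝ) : qEx (x, t) =
    6 * exp (4 * I * t) * exp (-2 * x)
      * (18 * exp (2 * x) ^ 3 + 0 * exp (2 * x) ^ 2 + (-27 * I) * exp (2 * x)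
        + (-4 * I * exp (4 * I * t) ^ 3))
      * (18 * exp (2 * x) ^ 3 + 6 * exp (4 * I * t) ^ 3 * exp (2 * x) ^ 2 + 0 * exp (2 * x)
        + (-I * exp (4 * I * t) ^ 3))
      / (18 * exp (2 * x) ^ 3 + 0 * exp (2 * x) ^ 2 + (27 * I) * exp (2 * x)
        + (8 * I * exp (4 * I * t) ^ 3)) ^ 2 := by
  have e1 : exp (6 * (x : ℂ)) = exp (2 * x) ^ 3 := by rw [← exp_nat_mul]; congr 1; push_cast; ring
  have e2 : exp (4 * (x : ℂ)) = exp (2 * x) ^ 2 := by rw [← exp_nat_mul]; congr 1; push_cast; ring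
  have e3 : exp (12 * I * (t : ℂ)) = exp (4 * I * t) ^ 3 := by
    rw [← exp_nat_mul]; congr 1; push_cast; ring
  simp only [qEx, exp_add, e1, e2, e3]
  congr 1 <;> ring

open Complex in
lemma rEx_eq (x t : ℝ) : rEx (x, t) =
    72 * exp (-(4 * I) * t) * exp (2 * x) ^ 2
      * (18 * exp (2 * x) ^ 3 + 0 * exp (2 * x) ^ 2 + (27 * I) * exp (2 * x)
        + (8 * I * exp (4 * I * t) ^ 3))
      / (18 * exp (2 * x) ^ 3 + 0 * exp (2 * x) ^ 2 + (-27 * I) * exp (2 * x)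
        + (-4 * I * exp (4 * I * t) ^ 3)) ^ 2 := by
  have e1 : exp (6 * (x : ℂ)) = exp (2 * x) ^ 3 := by rw [← exp_nat_mul]; congr 1; push_cast; ring
  have e2 : exp (4 * (x : ℂ)) = exp (2 * x) ^ 2 := by rw [← exp_nat_mul]; congr 1; push_cast; ring
  have e3 : exp (12 * I * (t : ℂ)) = exp (4 * I * t) ^ 3 := by
    rw [← exp_nat_mul]; congr 1; push_cast; ring
  have e4 : 4 * (x : ℂ) - 4 * I * t = 4 * x + -(4 * I) * t := by ring
  simp only [rEx, e4, exp_add, e1, e2, e3]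
  rw [← neg_div_neg_eq, neg_neg]
  congr 1
  · ring
  · linear_combination (-(18 * exp (2 * (x : ℂ)) ^ 3) ^ 2
      + (-27 * exp (2 * (x : ℂ)) - 4 * exp (4 * I * t) ^ 3) ^ 2 * (-1)) * I_sq


open Complex in
lemma kn_core (X Y T U : ℝ → ℂ) (x t : ℝ)
    (h1 : 18 * X x ^ 3 + 27 * I * X x + 8 * I * T t ^ 3 ≠ 0)
    (h2 : 18 * I * X x ^ 3 + 27 * X x + 4 * T t ^ 3 ≠ 0)
    (hX : ∀ s, HasDerivAt X (2 * X s) s) (hY : ∀ s, HasDerivAt Y (-2 * Y s) s)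
    (hT : ∀ s, HasDerivAt T (4 * I * T s) s) (hU : ∀ s, HasDerivAt U (-(4 * I) * U s) s)
    (hXY : ∀ s, X s * Y s = 1) (hTU : ∀ s, T s * U s = 1)
    (hq : ∀ x t, qEx (x, t) = 6 * T t * Y x
      * (18 * X x ^ 3 + 0 * X x ^ 2 + (-27 * I) * X x + (-4 * I * T t ^ 3))
      * (18 * X x ^ 3 + 6 * T t ^ 3 * X x ^ 2 + 0 * X x + (-I * T t ^ 3))
      / (18 * X x ^ 3 + 0 * X x ^ 2 + (27 * I) * X x + (8 * I * T t ^ 3)) ^ 2)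
    (hr : ∀ x t, rEx (x, t) = 72 * U t * X x ^ 2
      * (18 * X x ^ 3 + 0 * X x ^ 2 + (27 * I) * X x + (8 * I * T t ^ 3))
      / (18 * X x ^ 3 + 0 * X x ^ 2 + (-27 * I) * X x + (-4 * I * T t ^ 3)) ^ 2) :
    I * pdt qEx (x, t) + pdxx qEx (x, t)
          - I * deriv (fun s => (qEx (s, t)) ^ 2 * rEx (s, t)) x = 0 ∧
        I * pdt rEx (x, t) - pdxx rEx (x, t)
          - I * deriv (fun s => qEx (s, t) * (rEx (s, t)) ^ 2) x = 0 := by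
  have hN := fun s => hasDerivAt_cubic (hX s) 18 0 (-27 * I) (-4 * I * T t ^ 3)
  have hN1 := fun s => hasDerivAt_cubic (hX s) (3 * 2 * 18) (2 * 2 * 0) (2 * (-27 * I)) 0
  have hD := fun s => hasDerivAt_cubic (hX s) 18 0 (27 * I) (8 * I * T t ^ 3)
  have hD1 := fun s => hasDerivAt_cubic (hX s) (3 * 2 * 18) (2 * 2 * 0) (2 * (27 * I)) 0
  have hM := fun s => hasDerivAt_cubic (hX s) 18 (6 * T t ^ 3) 0 (-I * T t ^ 3)
  have hM1 := fun s => hasDerivAt_cubic (hX s) (3 * 2 * 18) (2 * 2 * (6 * T t ^ 3)) (2 * 0) 0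
  have hDne : 18 * X x ^ 3 + 0 * X x ^ 2 + (27 * I) * X x + (8 * I * T t ^ 3) ≠ 0 := by
    intro h; apply h1; linear_combination h
  have hNne : 18 * X x ^ 3 + 0 * X x ^ 2 + (-27 * I) * X x + (-4 * I * T t ^ 3) ≠ 0 := by
    intro h; apply h2
    linear_combination I * h + (27 * X x + 4 * T t ^ 3) * I_sq
  have hDev := (hD x).continuousAt.eventually_ne hDne
  have hNev := (hN x).continuousAt.eventually_ne hNne
  have hTcub : HasDerivAt (fun s => T s ^ 3) (12 * I * T t ^ 3) t := by
    have := (hT t).pow 3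
    exact this.congr_deriv (by push_cast; ring)
  have hTN := (hTcub.const_mul (-4 * I)).const_add (18 * X x ^ 3 + 0 * X x ^ 2 + (-27 * I) * X x)
  have hTD := (hTcub.const_mul (8 * I)).const_add (18 * X x ^ 3 + 0 * X x ^ 2 + (27 * I) * X x)
  have hTM : HasDerivAt (fun s => 18 * X x ^ 3 + 6 * T s ^ 3 * X x ^ 2 + 0 * X x + (-I * T s ^ 3))
      (12 * I * T t ^ 3 * (6 * X x ^ 2 - I)) t := by
    have := (hTcub.mul_const (6 * X x ^ 2 - I)).const_add (18 * X x ^ 3)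
    exact this.congr_of_eventuallyEq (Filter.Eventually.of_forall fun s => by ring)
  have hX2 : ∀ s, HasDerivAt (fun s => X s ^ 2) (4 * X s ^ 2) s := fun s =>
    ((hX s).pow 2).congr_deriv (by push_cast; ring)
  have hX3 : ∀ s, HasDerivAt (fun s => X s ^ 3) (6 * X s ^ 3) s := fun s =>
    ((hX s).pow 3).congr_deriv (by push_cast; ring)
  have p3 : I ^ 3 = -I := by linear_combination I * I_sq
  have p4 : I ^ 4 = 1 := by linear_combination (I ^ 2 - 1) * I_sq
  have p5 : I ^ 5 = I := by linear_combination I * p4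
  have p6 : I ^ 6 = -1 := by linear_combination I ^ 2 * p4 + I_sq
  have p7 : I ^ 7 = -I := by linear_combination I ^ 3 * p4 + p3
  have p8 : I ^ 8 = 1 := by linear_combination (I ^ 4 + 1) * p4
  constructor
  · have := kn_generic qEx (fun s => (qEx (s, t)) ^ 2 * rEx (s, t))
      (fun s => 6 * T t * Y s
        * (18 * X s ^ 3 + 0 * X s ^ 2 + (-27 * I) * X s + (-4 * I * T t ^ 3))
        * (18 * X s ^ 3 + 6 * T t ^ 3 * X s ^ 2 + 0 * X s + (-I * T t ^ 3)))
      _ (fun _ => _)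
      (fun s => 18 * X s ^ 3 + 0 * X s ^ 2 + (27 * I) * X s + (8 * I * T t ^ 3))
      _ (fun _ => _)
      (fun s => 2592 * (T t * (X x * Y x)) *
        (18 * X s ^ 3 + 6 * T t ^ 3 * X s ^ 2 + 0 * X s + (-I * T t ^ 3)) ^ 2)
      (fun s => 6 * T s * Y x
        * (18 * X x ^ 3 + 0 * X x ^ 2 + (-27 * I) * X x + (-4 * I * T s ^ 3))
        * (18 * X x ^ 3 + 6 * T s ^ 3 * X x ^ 2 + 0 * X x + (-I * T s ^ 3)))
      (fun s => 18 * X x ^ 3 + 0 * X x ^ 2 + (27 * I) * X x + (8 * I * T s ^ 3))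
      x t 1 _ _ _ (fun s => hq s t) (fun s => hq x s) rfl rfl ?_
      (fun s => (((hY s).const_mul (6 * T t)).mul (hN s)).mul (hM s))
      ((((((hY x).const_mul (-2)).const_mul (6 * T t)).mul (hN x)).add
        (((hY x).const_mul (6 * T t)).mul (hN1 x))).mul (hM x) |>.add
        ((((hY x).const_mul (6 * T t)).mul (hN x)).mul (hM1 x)))
      hD (hD1 x) (((hM x).pow 2).const_mul _)
      ((((((hT t).const_mul 6).mul_const (Y x)).mul hTN)).mul hTM) hTD hDne ?_
    · rw [one_mul] at this; exact this
    · filter_upwards [hDev, hNev] with s hd hn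
      rw [hq, hr]
      generalize hDg : 18 * X s ^ 3 + 0 * X s ^ 2 + (27 * I) * X s + (8 * I * T t ^ 3) = d at *
      generalize hNg : 18 * X s ^ 3 + 0 * X s ^ 2 + (-27 * I) * X s + (-4 * I * T t ^ 3) = n at *
      generalize 18 * X s ^ 3 + 6 * T t ^ 3 * X s ^ 2 + 0 * X s + (-I * T t ^ 3) = m at *
      field_simp
      have hy := hXY s
      have hu := hTU t
      have : 6 ^ 2 * T t ^ 2 * Y s ^ 2 * 72 * U t * X s ^ 2 = 2592 * T t * (X s * Y s) ^ 2 * (T t * U t) := by ring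
      rw [hy, hu] at this
      linear_combination m ^ 2 * this - 2592 * T t * m ^ 2 * hXY x
    · simp only [Pi.mul_apply, Pi.add_apply, Pi.pow_apply]
      ring_nf
      simp only [I_sq, p3, p4, p5, p6, p7, p8]
      ring_nf
  · have := kn_generic rEx (fun s => qEx (s, t) * (rEx (s, t)) ^ 2)
      (fun s => 72 * U t * X s ^ 2
        * (18 * X s ^ 3 + 0 * X s ^ 2 + (27 * I) * X s + (8 * I * T t ^ 3)))
      _ (fun _ => _)
      (fun s => 18 * X s ^ 3 + 0 * X s ^ 2 + (-27 * I) * X s + (-4 * I * T t ^ 3))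
      _ (fun _ => _)
      (fun s => 31104 * U t * X s ^ 3 *
        (18 * X s ^ 3 + 6 * T t ^ 3 * X s ^ 2 + 0 * X s + (-I * T t ^ 3)))
      (fun s => 72 * U s * X x ^ 2
        * (18 * X x ^ 3 + 0 * X x ^ 2 + (27 * I) * X x + (8 * I * T s ^ 3)))
      (fun s => 18 * X x ^ 3 + 0 * X x ^ 2 + (-27 * I) * X x + (-4 * I * T s ^ 3))
      x t (-1) _ _ _ (fun s => hr s t) (fun s => hr x s) rfl rfl ?_
      (fun s => ((hX2 s).const_mul (72 * U t)).mul (hD s))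
      (((((hX2 x).const_mul 4).const_mul (72 * U t)).mul (hD x)).add
        (((hX2 x).const_mul (72 * U t)).mul (hD1 x)))
      hN (hN1 x) (((hX3 x).const_mul _).mul (hM x))
      ((((hU t).const_mul 72).mul_const (X x ^ 2)).mul hTD) hTN hNne ?_
    · linear_combination this
    · filter_upwards [hDev, hNev] with s hd hn
      rw [hq, hr]
      generalize hDg : 18 * X s ^ 3 + 0 * X s ^ 2 + (27 * I) * X s + (8 * I * T t ^ 3) = d at *
      generalize hNg : 18 * X s ^ 3 + 0 * X s ^ 2 + (-27 * I) * X s + (-4 * I * T t ^ 3) = n at *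
      generalize 18 * X s ^ 3 + 6 * T t ^ 3 * X s ^ 2 + 0 * X s + (-I * T t ^ 3) = m at *
      field_simp
      have hy := hXY s
      have hu := hTU t
      have : 6 * T t * Y s * 72 ^ 2 * U t ^ 2 * X s ^ 4
          = 31104 * U t * X s ^ 3 * (X s * Y s) * (T t * U t) := by ring
      rw [hy, hu] at this
      linear_combination m * this
    · ring_nf
      simp only [I_sq, p3, p4, p5, p6, p7, p8]
      ring_nf

/-- At every point where both denominators are nonzero, the explicit pair `(q, r)`
satisfies the Kaup–Newell system. -/
theorem stmt18 :
    ∀ x t : ℝ,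
      18 * Complex.exp (6 * (x : ℂ)) + 27 * Complex.I * Complex.exp (2 * (x : ℂ))
          + 8 * Complex.I * Complex.exp (12 * Complex.I * (t : ℂ)) ≠ 0 →
      18 * Complex.I * Complex.exp (6 * (x : ℂ)) + 27 * Complex.exp (2 * (x : ℂ))
          + 4 * Complex.exp (12 * Complex.I * (t : ℂ)) ≠ 0 →
      (Complex.I * pdt qEx (x, t) + pdxx qEx (x, t)
          - Complex.I * deriv (fun s => (qEx (s, t)) ^ 2 * rEx (s, t)) x = 0 ∧
        Complex.I * pdt rEx (x, t) - pdxx rEx (x, t)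
          - Complex.I * deriv (fun s => qEx (s, t) * (rEx (s, t)) ^ 2) x = 0) := by
  intro x t h1 h2
  have e1 : Complex.exp (6 * (x : ℂ)) = Complex.exp (2 * x) ^ 3 := by
    rw [← Complex.exp_nat_mul]; congr 1; push_cast; ring
  have e3 : Complex.exp (12 * Complex.I * (t : ℂ)) = Complex.exp (4 * Complex.I * t) ^ 3 := by
    rw [← Complex.exp_nat_mul]; congr 1; push_cast; ring
  rw [e1, e3] at h1 h2
  have hXd : ∀ s : ℝ, HasDerivAt (fun s : ℝ => Complex.exp (2 * (s : ℂ)))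
    (2 * Complex.exp (2 * (s : ℂ))) s := hasDerivAt_cexp_mul 2
  have hYd : ∀ s : ℝ, HasDerivAt (fun s : ℝ => Complex.exp (-2 * (s : ℂ)))
    (-2 * Complex.exp (-2 * (s : ℂ))) s := hasDerivAt_cexp_mul (-2)
  have hTd : ∀ s : ℝ, HasDerivAt (fun s : ℝ => Complex.exp (4 * Complex.I * (s : ℂ)))
    (4 * Complex.I * Complex.exp (4 * Complex.I * (s : ℂ))) s := hasDerivAt_cexp_mul _
  have hUd : ∀ s : ℝ, HasDerivAt (fun s : ℝ => Complex.exp (-(4 * Complex.I) * (s : ℂ)))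
    (-(4 * Complex.I) * Complex.exp (-(4 * Complex.I) * (s : ℂ))) s := hasDerivAt_cexp_mul _
  have hXY : ∀ s : ℝ, Complex.exp (2 * (s : ℂ)) * Complex.exp (-2 * (s : ℂ)) = 1 := by
    intro s; rw [← Complex.exp_add]; simp
  have hTU : ∀ s : ℝ, Complex.exp (4 * Complex.I * (s : ℂ)) *
      Complex.exp (-(4 * Complex.I) * (s : ℂ)) = 1 := by
    intro s; rw [← Complex.exp_add]; simp
  have hq := qEx_eq
  have hr := rEx_eq
  generalize hX : (fun s : ℝ => Complex.exp (2 * (s : ℂ))) = X at hXd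
  generalize hY : (fun s : ℝ => Complex.exp (-2 * (s : ℂ))) = Y at hYd
  generalize hT : (fun s : ℝ => Complex.exp (4 * Complex.I * (s : ℂ))) = T at hTd
  generalize hU : (fun s : ℝ => Complex.exp (-(4 * Complex.I) * (s : ℂ))) = U at hUd
  have hX' : ∀ s : ℝ, Complex.exp (2 * (s : ℂ)) = X s := fun s => by rw [← hX]
  have hY' : ∀ s : ℝ, Complex.exp (-2 * (s : ℂ)) = Y s := fun s => by rw [← hY]
  have hT' : ∀ s : ℝ, Complex.exp (4 * Complex.I * (s : ℂ)) = T s := fun s => by rw [← hT]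
  have hU' : ∀ s : ℝ, Complex.exp (-(4 * Complex.I) * (s : ℂ)) = U s := fun s => by rw [← hU]
  simp only [hX', hY', hT', hU'] at hXd hYd hTd hUd hXY hTU hq hr h1 h2
  clear hX hY hT hU hX' hY' hT' hU' e1 e3
  exact kn_core X Y T U x t h1 h2 hXd hYd hTd hUd hXY hTU hq hr
end

section
/- Define w₁₇(x,t) := x + 4it − 8 e^{4x}(−i + 8t + 2ix) and w₁₈(x,t) := −i + 256 i e^{8x} + 32 e^{4x}(1 − 4x + 8x² + 16it + 128t²). Then: (a) w₁₈(x,t) ≠ 0 for every (x,t) ∈ ℝ² (indeed its real part equals 32 e^{4x}(1 − 4x + 8x² + 128t²) > 0); (b) the functions q̃(x,t) := (64 w₁₇(x,t) / w₁₈(x,t)) · e^{2x + 4it} and r̃(x,t) := conj(q̃(x,t)) satisfy the Gerdjikov–Ivanov system i q̃_t + q̃_xx + i q̃² r̃_x + (1/2) q̃³ r̃² = 0 and i r̃_t − r̃_xx + i q̃_x r̃² − (1/2) q̃² r̃³ = 0 at every (x,t) ∈ ℝ². -/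
/-- `w₁₇(x,t) = x + 4it − 8 e^{4x}(−i + 8t + 2ix)`. -/
noncomputable def w17 (x t : ℝ) : ℂ :=
  (x : ℂ) + 4 * Complex.I * (t : ℂ)
    - 8 * Complex.exp (4 * (x : ℂ))
        * (-Complex.I + 8 * (t : ℂ) + 2 * Complex.I * (x : ℂ))

/-- `w₁₈(x,t) = −i + 256 i e^{8x} + 32 e^{4x}(1 − 4x + 8x² + 16it + 128t²)`. -/
noncomputable def w18 (x t : ℝ) : ℂ :=
  -Complex.I + 256 * Complex.I * Complex.exp (8 * (x : ℂ))
    + 32 * Complex.exp (4 * (x : ℂ))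
        * (1 - 4 * (x : ℂ) + 8 * (x : ℂ) ^ 2 + 16 * Complex.I * (t : ℂ) + 128 * (t : ℂ) ^ 2)

/-- The explicit solution `q̃ = (64 w₁₇ / w₁₈) e^{2x+4it}` of the Gerdjikov–Ivanov system. -/
noncomputable def qGI (p : ℝ × ℝ) : ℂ :=
  64 * w17 p.1 p.2 / w18 p.1 p.2
    * Complex.exp (2 * (p.1 : ℂ) + 4 * Complex.I * (p.2 : ℂ))

/-- `r̃ = conj q̃`. -/
noncomputable def rGI (p : ℝ × ℝ) : ℂ :=
  (starRingEnd ℂ) (qGI p)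

open Complex in
/-- Hirota-type reduction: the bilinear identities imply the first GI equation. -/
lemma gi_of_bilinear (f fx fxx ft k kx kxx kt g gx gxx gt h hx : ℂ) (hf : f ≠ 0) (hk : k ≠ 0)
    (B1 : I * (gt * f - g * ft) + (gxx * f - 2 * gx * fx + g * fxx) = 0)
    (B1k : I * (gt * k - g * kt) + (gxx * k - 2 * gx * kx + g * kxx) = 0)
    (B3 : I * (ft * k - f * kt) - (fxx * k - 2 * fx * kx + f * kxx) = 0)
    (B2 : g * h = -2 * I * (fx * k - f * kx))
    (B2x : gx * h + g * hx = -2 * I * (fxx * k - f * kxx)) :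
    I * ((gt * f - g * ft) / f ^ 2)
      + ((gxx * f - g * fxx) * f ^ 2 - (gx * f - g * fx) * (2 * f * fx)) / (f ^ 2) ^ 2
      + I * (g / f) ^ 2 * ((hx * k - h * kx) / k ^ 2)
      + (1 / 2) * (g / f) ^ 3 * (h / k) ^ 2 = 0 := by
  have hI : I ^ 2 = -1 := I_sq
  have e1 : g * (hx * k - h * kx)
      = -2 * I * ((fxx * k - f * kxx) * k - (fx * k - f * kx) * kx)
        - gx * h * k := by
    linear_combination k * B2x - kx * B2
  have e2 : g * (g * (hx * k - h * kx))
      = -2 * I * (g * ((fxx * k - f * kxx) * k - (fx * k - f * kx) * kx)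
        - gx * (fx * k - f * kx) * k) := by
    rw [e1]; linear_combination (-gx * k) * B2
  have e3 : g ^ 3 * h ^ 2 = -4 * g * (fx * k - f * kx) ^ 2 := by
    have : g ^ 3 * h ^ 2 = g * (g * h) ^ 2 := by ring
    rw [this, B2]; linear_combination (4 * g * (fx * k - f * kx) ^ 2) * hI
  have e4 : I * (g ^ 2 * (hx * k - h * kx))
      = 2 * (g * ((fxx * k - f * kxx) * k - (fx * k - f * kx) * kx)
        - gx * (fx * k - f * kx) * k) := by
    have : g ^ 2 * (hx * k - h * kx) = g * (g * (hx * k - h * kx)) := by ring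
    rw [this, e2]
    linear_combination (-2 * (g * ((fxx * k - f * kxx) * k - (fx * k - f * kx) * kx)
        - gx * (fx * k - f * kx) * k)) * hI
  have key : I * (gt * f - g * ft) * f * k ^ 2
      + ((gxx * f - g * fxx) * f - (gx * f - g * fx) * (2 * fx)) * k ^ 2
      + I * (g ^ 2 * (hx * k - h * kx)) * f + (1 / 2) * (g ^ 3 * h ^ 2) = 0 := by
    rw [e4, e3]
    linear_combination (2 * f * k ^ 2) * B1 - f ^ 2 * k * B1k + (f * k * g) * B3
  have : I * ((gt * f - g * ft) / f ^ 2)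
      + ((gxx * f - g * fxx) * f ^ 2 - (gx * f - g * fx) * (2 * f * fx)) / (f ^ 2) ^ 2
      + I * (g / f) ^ 2 * ((hx * k - h * kx) / k ^ 2)
      + (1 / 2) * (g / f) ^ 3 * (h / k) ^ 2
      = (I * (gt * f - g * ft) * f * k ^ 2
      + ((gxx * f - g * fxx) * f - (gx * f - g * fx) * (2 * fx)) * k ^ 2
      + I * (g ^ 2 * (hx * k - h * kx)) * f + (1 / 2) * (g ^ 3 * h ^ 2)) / (f ^ 3 * k ^ 2) := by
    field_simp
  rw [this, key, zero_div]

/-! Polynomial forms of `w17`, `w18` and their derivatives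
(`i` the imaginary unit, `e = exp (4x)`). -/

def pN (i e x t : ℂ) : ℂ := x + 4 * i * t - 8 * e * (-i + 8 * t + 2 * i * x)
def pNx (i e x t : ℂ) : ℂ := 1 - 8 * e * (4 * (-i + 8 * t + 2 * i * x) + 2 * i)
def pNxx (i e x t : ℂ) : ℂ := -8 * e * (16 * (-i + 8 * t + 2 * i * x) + 16 * i)
def pNt (i e : ℂ) : ℂ := 4 * i - 64 * e
def pS (i x t : ℂ) : ℂ := 1 - 4 * x + 8 * x ^ 2 + 16 * i * t + 128 * t ^ 2
def pD (i e x t : ℂ) : ℂ := -i + 256 * i * e ^ 2 + 32 * e * pS i x t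
def pDx (i e x t : ℂ) : ℂ := 2048 * i * e ^ 2 + 32 * e * (4 * pS i x t - 4 + 16 * x)
def pDxx (i e x t : ℂ) : ℂ :=
  16384 * i * e ^ 2 + 32 * e * (16 * pS i x t + 8 * (-4 + 16 * x) + 16)
def pDt (i e t : ℂ) : ℂ := 32 * e * (16 * i + 256 * t)

lemma poly_B1 (i e x t : ℂ) (hi : i ^ 2 = -1) :
    i * ((pNt i e + 4 * i * pN i e x t) * pD i e x t - pN i e x t * pDt i e t)
    + ((pNxx i e x t + 4 * pNx i e x t + 4 * pN i e x t) * pD i e x t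
      - 2 * (pNx i e x t + 2 * pN i e x t) * pDx i e x t + pN i e x t * pDxx i e x t) = 0 := by
  simp only [pN, pNx, pNxx, pNt, pS, pD, pDx, pDxx, pDt]
  grind

lemma poly_B1k (i e x t : ℂ) (hi : i ^ 2 = -1) :
    i * ((pNt i e + 4 * i * pN i e x t) * pD (-i) e x t - pN i e x t * pDt (-i) e t)
    + ((pNxx i e x t + 4 * pNx i e x t + 4 * pN i e x t) * pD (-i) e x t
      - 2 * (pNx i e x t + 2 * pN i e x t) * pDx (-i) e x t + pN i e x t * pDxx (-i) e x t)
      = 0 := by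
  simp only [pN, pNx, pNxx, pNt, pS, pD, pDx, pDxx, pDt]
  grind

lemma poly_B3 (i e x t : ℂ) (hi : i ^ 2 = -1) :
    i * (pDt i e t * pD (-i) e x t - pD i e x t * pDt (-i) e t)
    - (pDxx i e x t * pD (-i) e x t - 2 * pDx i e x t * pDx (-i) e x t
      + pD i e x t * pDxx (-i) e x t) = 0 := by
  simp only [pS, pD, pDx, pDxx, pDt]
  grind

lemma poly_B2 (i e x t : ℂ) (hi : i ^ 2 = -1) :
    4096 * e * pN i e x t * pN (-i) e x t
      = -2 * i * (pDx i e x t * pD (-i) e x t - pD i e x t * pDx (-i) e x t) := by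
  simp only [pN, pS, pD, pDx]
  grind

lemma poly_B2x (i e x t : ℂ) (hi : i ^ 2 = -1) :
    4096 * e * ((pNx i e x t + 2 * pN i e x t) * pN (-i) e x t
      + pN i e x t * (pNx (-i) e x t + 2 * pN (-i) e x t))
      = -2 * i * (pDxx i e x t * pD (-i) e x t - pD i e x t * pDxx (-i) e x t) := by
  simp only [pN, pNx, pS, pD, pDxx]
  grind

noncomputable def eE (x : ℝ) : ℂ := Complex.exp (4 * (x : ℂ))
noncomputable def zZ (x t : ℝ) : ℂ := Complex.exp (2 * (x : ℂ) + 4 * Complex.I * (t : ℂ))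

lemma w17_eq (x t : ℝ) : w17 x t = pN Complex.I (eE x) x t := rfl

lemma w18_eq (x t : ℝ) : w18 x t = pD Complex.I (eE x) x t := by
  have : Complex.exp (8 * (x : ℂ)) = Complex.exp (4 * (x : ℂ)) ^ 2 := by
    rw [← Complex.exp_nat_mul]; congr 1; push_cast; ring
  simp only [w18, pD, pS, eE, this]

lemma conj_eE (x : ℝ) : (starRingEnd ℂ) (eE x) = eE x := by
  simp [eE, ← Complex.exp_conj, map_ofNat]

lemma zZ_mul_conj (x t : ℝ) : zZ x t * (starRingEnd ℂ) (zZ x t) = eE x := by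
  simp only [zZ, eE, ← Complex.exp_conj, ← Complex.exp_add]
  congr 1
  simp [map_ofNat]
  ring

lemma w18_re (x t : ℝ) :
    (w18 x t).re = 32 * Real.exp (4 * x) * (1 - 4 * x + 8 * x ^ 2 + 128 * t ^ 2) := by
  have h1 : Complex.exp (8 * (x : ℂ)) = ((Real.exp (8 * x) : ℝ) : ℂ) := by push_cast; rfl
  have h2 : Complex.exp (4 * (x : ℂ)) = ((Real.exp (4 * x) : ℝ) : ℂ) := by push_cast; rfl
  have : w18 x t = ((32 * Real.exp (4 * x) * (1 - 4 * x + 8 * x ^ 2 + 128 * t ^ 2) : ℝ) : ℂ)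
      + ((-1 + 256 * Real.exp (8 * x) + 32 * Real.exp (4 * x) * (16 * t) : ℝ) : ℂ)
        * Complex.I := by
    unfold w18
    rw [h1, h2]; push_cast; ring
  rw [this]; simp only [Complex.add_re, Complex.re_ofReal_mul, Complex.I_re, Complex.ofReal_re]
  ring

lemma w18_re_pos (x t : ℝ) : 0 < (w18 x t).re := by
  rw [w18_re]
  have := Real.exp_pos (4 * x)
  have : 0 < 1 - 4 * x + 8 * x ^ 2 + 128 * t ^ 2 := by
    nlinarith [sq_nonneg (4 * x - 1), sq_nonneg t]
  positivity

lemma w18_ne (x t : ℝ) : w18 x t ≠ 0 := by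
  intro h
  have := w18_re_pos x t
  rw [h] at this
  simp at this

lemma pD_ne (x t : ℝ) : pD Complex.I (eE x) x t ≠ 0 := by
  rw [← w18_eq]; exact w18_ne x t

lemma hd_x (x : ℝ) : HasDerivAt (fun s : ℝ => (s : ℂ)) 1 x := Complex.ofRealCLM.hasDerivAt

lemma hd_eE (x : ℝ) : HasDerivAt eE (4 * eE x) x := by
  have := ((hd_x x).const_mul 4).cexp
  unfold eE
  refine HasDerivAt.congr_deriv this ?_
  ring

lemma hd_zx (x t : ℝ) : HasDerivAt (fun s => zZ s t) (2 * zZ x t) x := by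
  have := (((hd_x x).const_mul 2).add_const (4 * Complex.I * (t : ℂ))).cexp
  unfold zZ
  refine HasDerivAt.congr_deriv this ?_
  ring

lemma hd_zt (x t : ℝ) : HasDerivAt (fun s => zZ x s) (4 * Complex.I * zZ x t) t := by
  have := (((hd_x t).const_mul (4 * Complex.I)).const_add (2 * (x : ℂ))).cexp
  unfold zZ
  refine HasDerivAt.congr_deriv this ?_
  ring

lemma hd_lin (x t : ℝ) (i : ℂ) :
    HasDerivAt (fun s : ℝ => -i + 8 * (t : ℂ) + 2 * i * (s : ℂ)) (2 * i) x := by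
  have := ((hd_x x).const_mul (2 * i)).const_add (-i + 8 * (t : ℂ))
  refine HasDerivAt.congr_deriv this ?_
  ring

lemma hd_S (x t : ℝ) (i : ℂ) :
    HasDerivAt (fun s : ℝ => pS i s t) (-4 + 16 * (x : ℂ)) x := by
  have := (((((hd_x x).const_mul 4).const_sub 1).add (((hd_x x).pow 2).const_mul 8)).add_const
    (16 * i * (t : ℂ))).add_const (128 * (t : ℂ) ^ 2)
  unfold pS
  refine HasDerivAt.congr_deriv this ?_
  push_cast
  ring

lemma hd_Nx (x t : ℝ) (i : ℂ) :
    HasDerivAt (fun s : ℝ => pN i (eE s) s t) (pNx i (eE x) x t) x := by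
  have := ((hd_x x).add_const (4 * i * (t : ℂ))).sub
    (((hd_eE x).const_mul 8).mul (hd_lin x t i))
  unfold pN pNx
  refine HasDerivAt.congr_deriv this ?_
  ring

lemma hd_Nxx (x t : ℝ) (i : ℂ) :
    HasDerivAt (fun s : ℝ => pNx i (eE s) s t) (pNxx i (eE x) x t) x := by
  have := (((hd_eE x).const_mul 8).mul (((hd_lin x t i).const_mul 4).add_const
    (2 * i))).const_sub 1
  unfold pNx pNxx
  refine HasDerivAt.congr_deriv this ?_
  ring

lemma hd_Nt (x t : ℝ) (i : ℂ) :
    HasDerivAt (fun s : ℝ => pN i (eE x) x s) (pNt i (eE x)) t := by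
  have := (((hd_x t).const_mul (4 * i)).const_add (x : ℂ)).sub
    (((((hd_x t).const_mul 8).const_add (-i)).add_const (2 * i * (x : ℂ))).const_mul
      (8 * eE x))
  unfold pN pNt
  refine HasDerivAt.congr_deriv this ?_
  ring

lemma hd_Dx (x t : ℝ) (i : ℂ) :
    HasDerivAt (fun s : ℝ => pD i (eE s) s t) (pDx i (eE x) x t) x := by
  have := ((((hd_eE x).pow 2).const_mul (256 * i)).const_add (-i)).add
    (((hd_eE x).const_mul 32).mul (hd_S x t i))
  unfold pD pDx
  refine HasDerivAt.congr_deriv this ?_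
  push_cast
  ring

lemma hd_Dxx (x t : ℝ) (i : ℂ) :
    HasDerivAt (fun s : ℝ => pDx i (eE s) s t) (pDxx i (eE x) x t) x := by
  have := (((hd_eE x).pow 2).const_mul (2048 * i)).add
    (((hd_eE x).const_mul 32).mul
      ((((hd_S x t i).const_mul 4).sub_const 4).add ((hd_x x).const_mul 16)))
  unfold pDx pDxx
  refine HasDerivAt.congr_deriv this ?_
  simp only [Pi.add_apply]
  push_cast
  ring

lemma hd_Dt (x t : ℝ) (i : ℂ) :
    HasDerivAt (fun s : ℝ => pD i (eE x) x s) (pDt i (eE x) t) t := by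
  have := (((((hd_x t).const_mul (16 * i)).const_add (1 - 4 * (x : ℂ) + 8 * (x : ℂ) ^ 2)).add
    (((hd_x t).pow 2).const_mul 128)).const_mul (32 * eE x)).const_add
      (-i + 256 * i * eE x ^ 2)
  unfold pD pDt pS
  refine HasDerivAt.congr_deriv this ?_
  push_cast
  ring

/-- numerator `g` and derivatives -/
noncomputable def gG (x t : ℝ) : ℂ := 64 * pN Complex.I (eE x) x t * zZ x t
noncomputable def gGx (x t : ℝ) : ℂ :=
  64 * (pNx Complex.I (eE x) x t + 2 * pN Complex.I (eE x) x t) * zZ x t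
noncomputable def gGxx (x t : ℝ) : ℂ :=
  64 * (pNxx Complex.I (eE x) x t + 4 * pNx Complex.I (eE x) x t
    + 4 * pN Complex.I (eE x) x t) * zZ x t
noncomputable def gGt (x t : ℝ) : ℂ :=
  64 * (pNt Complex.I (eE x) + 4 * Complex.I * pN Complex.I (eE x) x t) * zZ x t

lemma hd_gx (x t : ℝ) : HasDerivAt (fun s => gG s t) (gGx x t) x := by
  have := ((hd_Nx x t Complex.I).const_mul 64).mul (hd_zx x t)
  unfold gG gGx
  refine HasDerivAt.congr_deriv this ?_
  ring

lemma hd_gxx (x t : ℝ) : HasDerivAt (fun s => gGx s t) (gGxx x t) x := by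
  have := (((hd_Nxx x t Complex.I).add ((hd_Nx x t Complex.I).const_mul 2)).const_mul 64).mul
    (hd_zx x t)
  unfold gGx gGxx
  refine HasDerivAt.congr_deriv this ?_
  simp only [Pi.add_apply]
  ring

lemma hd_gt (x t : ℝ) : HasDerivAt (fun s => gG x s) (gGt x t) t := by
  have := ((hd_Nt x t Complex.I).const_mul 64).mul (hd_zt x t)
  unfold gG gGt
  refine HasDerivAt.congr_deriv this ?_
  ring

lemma qGI_eq (x t : ℝ) : qGI (x, t) = gG x t / pD Complex.I (eE x) x t := by
  simp only [qGI, gG, w17_eq, w18_eq, zZ]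
  ring

lemma pdx_q (x t : ℝ) : pdx qGI (x, t) =
    (gGx x t * pD Complex.I (eE x) x t - gG x t * pDx Complex.I (eE x) x t)
      / pD Complex.I (eE x) x t ^ 2 := by
  simp only [pdx, qGI_eq]
  exact ((hd_gx x t).div (hd_Dx x t Complex.I) (pD_ne x t)).deriv

lemma pdt_q (x t : ℝ) : pdt qGI (x, t) =
    (gGt x t * pD Complex.I (eE x) x t - gG x t * pDt Complex.I (eE x) t)
      / pD Complex.I (eE x) x t ^ 2 := by
  simp only [pdt, qGI_eq]
  exact ((hd_gt x t).div (hd_Dt x t Complex.I) (pD_ne x t)).deriv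

lemma pdxx_q (x t : ℝ) : pdxx qGI (x, t) =
    ((gGxx x t * pD Complex.I (eE x) x t - gG x t * pDxx Complex.I (eE x) x t)
        * pD Complex.I (eE x) x t ^ 2
      - (gGx x t * pD Complex.I (eE x) x t - gG x t * pDx Complex.I (eE x) x t)
        * (2 * pD Complex.I (eE x) x t * pDx Complex.I (eE x) x t))
      / (pD Complex.I (eE x) x t ^ 2) ^ 2 := by
  simp only [pdxx, pdx_q]
  have := ((((hd_gxx x t).mul (hd_Dx x t Complex.I)).sub
    ((hd_gx x t).mul (hd_Dxx x t Complex.I))).div ((hd_Dx x t Complex.I).pow 2)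
      (pow_ne_zero 2 (pD_ne x t))).deriv
  refine Eq.trans this ?_
  congr 1
  simp only [Pi.mul_apply, Pi.sub_apply, Pi.pow_apply]
  push_cast
  ring

lemma pdx_r (p : ℝ × ℝ) : pdx rGI p = (starRingEnd ℂ) (pdx qGI p) := by
  simp only [pdx, rGI]
  exact deriv.star

lemma pdt_r (p : ℝ × ℝ) : pdt rGI p = (starRingEnd ℂ) (pdt qGI p) := by
  simp only [pdt, rGI]
  exact deriv.star

lemma pdxx_r (p : ℝ × ℝ) : pdxx rGI p = (starRingEnd ℂ) (pdxx qGI p) := by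
  simp only [pdxx, pdx_r]
  exact deriv.star

lemma conj_pN (x t : ℝ) :
    (starRingEnd ℂ) (pN Complex.I (eE x) x t) = pN (-Complex.I) (eE x) x t := by
  simp [pN, conj_eE, map_ofNat]

lemma conj_pNx (x t : ℝ) :
    (starRingEnd ℂ) (pNx Complex.I (eE x) x t) = pNx (-Complex.I) (eE x) x t := by
  simp [pNx, conj_eE, map_ofNat]

lemma conj_pD (x t : ℝ) :
    (starRingEnd ℂ) (pD Complex.I (eE x) x t) = pD (-Complex.I) (eE x) x t := by
  simp [pD, pS, conj_eE, map_ofNat]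

lemma conj_pDx (x t : ℝ) :
    (starRingEnd ℂ) (pDx Complex.I (eE x) x t) = pDx (-Complex.I) (eE x) x t := by
  simp [pDx, pS, conj_eE, map_ofNat]

lemma gi_first (x t : ℝ) :
    Complex.I * pdt qGI (x, t) + pdxx qGI (x, t)
      + Complex.I * (qGI (x, t)) ^ 2 * pdx rGI (x, t)
      + (1 / 2) * (qGI (x, t)) ^ 3 * (rGI (x, t)) ^ 2 = 0 := by
  have hz := zZ_mul_conj x t
  have hr : rGI (x, t) = (64 * pN (-Complex.I) (eE x) x t * (starRingEnd ℂ) (zZ x t))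
      / pD (-Complex.I) (eE x) x t := by
    simp [rGI, qGI_eq, gG, conj_pN, conj_pD, map_ofNat]
  have hrx : pdx rGI (x, t) =
      ((64 * (pNx (-Complex.I) (eE x) x t + 2 * pN (-Complex.I) (eE x) x t)
        * (starRingEnd ℂ) (zZ x t)) * pD (-Complex.I) (eE x) x t
        - (64 * pN (-Complex.I) (eE x) x t * (starRingEnd ℂ) (zZ x t))
          * pDx (-Complex.I) (eE x) x t) / pD (-Complex.I) (eE x) x t ^ 2 := by
    rw [pdx_r, pdx_q]
    simp [gG, gGx, conj_pN, conj_pD, conj_pNx, conj_pDx, map_ofNat]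
  have hk : pD (-Complex.I) (eE x) x t ≠ 0 := by
    rw [← conj_pD]; simpa using pD_ne x t
  rw [hr, hrx, pdt_q, pdxx_q, qGI_eq]
  have hI := Complex.I_sq
  refine gi_of_bilinear _ _ _ _ _ _ (pDxx (-Complex.I) (eE x) x t)
    (pDt (-Complex.I) (eE x) t) _ _ _ _ _ _ (pD_ne x t) hk ?_ ?_ ?_ ?_ ?_
  · simp only [gG, gGx, gGxx, gGt]
    linear_combination (64 * zZ x t) * poly_B1 Complex.I (eE x) x t hI
  · simp only [gG, gGx, gGxx, gGt]
    linear_combination (64 * zZ x t) * poly_B1k Complex.I (eE x) x t hI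
  · exact poly_B3 Complex.I (eE x) x t hI
  · rw [← poly_B2 Complex.I (eE x) x t hI, ← hz]
    simp only [gG, hz]
    linear_combination (4096 * pN Complex.I (eE x) x t * pN (-Complex.I) (eE x) x t) * hz
  · rw [← poly_B2x Complex.I (eE x) x t hI]
    simp only [gG, gGx]
    linear_combination (4096 * ((pNx Complex.I (eE x) x t + 2 * pN Complex.I (eE x) x t)
      * pN (-Complex.I) (eE x) x t + pN Complex.I (eE x) x t *
      (pNx (-Complex.I) (eE x) x t + 2 * pN (-Complex.I) (eE x) x t))) * hz

/-- (a) `w₁₈` never vanishes on ℝ² (its real part equals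
`32 e^{4x}(1 − 4x + 8x² + 128t²) > 0`); (b) the pair `(q̃, r̃) = (64 w₁₇ e^{2x+4it}/w₁₈, q̃*)`
satisfies the Gerdjikov–Ivanov system at every point of ℝ². -/
theorem stmt19 :
    (∀ x t : ℝ,
      (w18 x t).re = 32 * Real.exp (4 * x) * (1 - 4 * x + 8 * x ^ 2 + 128 * t ^ 2) ∧
      0 < (w18 x t).re ∧ w18 x t ≠ 0) ∧
    (∀ x t : ℝ,
      Complex.I * pdt qGI (x, t) + pdxx qGI (x, t)
          + Complex.I * (qGI (x, t)) ^ 2 * pdx rGI (x, t)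
          + (1 / 2) * (qGI (x, t)) ^ 3 * (rGI (x, t)) ^ 2 = 0 ∧
      Complex.I * pdt rGI (x, t) - pdxx rGI (x, t)
          + Complex.I * pdx qGI (x, t) * (rGI (x, t)) ^ 2
          - (1 / 2) * (qGI (x, t)) ^ 2 * (rGI (x, t)) ^ 3 = 0) := by
  refine ⟨fun x t => ⟨w18_re x t, w18_re_pos x t, w18_ne x t⟩, fun x t => ⟨gi_first x t, ?_⟩⟩
  have h := congrArg (starRingEnd ℂ) (gi_first x t)
  have hq : (starRingEnd ℂ) (rGI (x, t)) = qGI (x, t) := by simp [rGI]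
  have hqr : (starRingEnd ℂ) (qGI (x, t)) = rGI (x, t) := rfl
  have hqx : (starRingEnd ℂ) (pdx rGI (x, t)) = pdx qGI (x, t) := by simp [pdx_r]
  simp only [map_add, map_mul, map_pow, map_zero, map_div₀, map_one, map_ofNat, Complex.conj_I,
    hq, hqr, hqx, ← pdt_r, ← pdxx_r] at h
  linear_combination -h
end
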